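/- (Distance decrease.) Let U be a finite set, let d and d' both be metrics on U such that d'(a,b) = d(a,b) − δ for one fixed unordered pair {a,b} of distinct elements and some δ > 0, and d'(u,v) = d(u,v) for all other pairs. Let w: U → ℝ be non-negative weights, λ ≥ 0, and write φ_d(S) = Σ_{u∈S} w(u) + λ·d(S) and φ_{d'}(S) = Σ_{u∈S} w(u) + λ·d'(S). Suppose S ⊆ U with |S| = p satisfies φ_d(S) ≥ (1/3)·φ_d(T) for every T ⊆ U with |T| = p, and let Δ = max(0, max over y ∈ S and x ∈ U∖S of φ_{d'}((S∖{y})∪{x}) − φ_{d'}(S)). Then φ_{d'}(S) + Δ ≥ (1/3)·φ_{d'}(T) for every T ⊆ U with |T| = p; i.e., for any metric-preserving distance decrease an approximation ratio of 3 is maintained with a single oblivious update. -/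

import Mathlib

open Finset

/-- `dispSet d S` is the sum of `d u v` over all unordered pairs `{u,v}` of distinct
elements of `S` (for a symmetric `d` with `d u u = 0`, half the double sum). -/
noncomputable def dispSet {U : Type*} (d : U → U → ℝ) (S : Finset U) : ℝ :=
  (∑ u ∈ S, ∑ v ∈ S, d u v) / 2

/-- The max-sum diversification objective `φ(S) = Σ_{u∈S} w(u) + λ·d(S)`
for a modular quality function given by weights `w`. -/
noncomputable def obj {U : Type*} (w : U → ℝ) (lam : ℝ) (d : U → U → ℝ)
    (S : Finset U) : ℝ :=
  ∑ u ∈ S, w u + lam * dispSet d S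

/-- `bestGain φ S = max(0, max over y ∈ S, x ∉ S of φ((S\{y})∪{x}) - φ(S))`:
the objective gain of the best single swap (the oblivious update rule). -/
noncomputable def bestGain {U : Type*} [Fintype U] [DecidableEq U]
    (φ : Finset U → ℝ) (S : Finset U) : ℝ :=
  (insert (0 : ℝ) ((S ×ˢ (Finset.univ \ S)).image
      fun pr => φ (insert pr.2 (S.erase pr.1)) - φ S)).max'
    (Finset.insert_nonempty _ _)

lemma obj_insert {U : Type*} [DecidableEq U] (d : U → U → ℝ)
    (hs : ∀ u v, d u v = d v u) (hr : ∀ u, d u u = 0) (w : U → ℝ) (lam : ℝ)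
    (c : U) (R : Finset U) (hc : c ∉ R) :
    obj w lam d (insert c R) = obj w lam d R + w c + lam * ∑ v ∈ R, d c v := by
  unfold obj dispSet
  rw [Finset.sum_insert hc, Finset.sum_insert hc, Finset.sum_insert hc]
  have : ∑ u ∈ R, ∑ v ∈ insert c R, d u v = ∑ v ∈ R, d c v + ∑ u ∈ R, ∑ v ∈ R, d u v := by
    rw [← Finset.sum_add_distrib]
    refine Finset.sum_congr rfl fun u _ => ?_
    rw [Finset.sum_insert hc, hs]
  rw [this, hr]
  ring

lemma gain_eq {U : Type*} [DecidableEq U] (d : U → U → ℝ)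
    (hs : ∀ u v, d u v = d v u) (hr : ∀ u, d u u = 0) (w : U → ℝ) (lam : ℝ)
    (S : Finset U) (b c : U) (hb : b ∈ S) (hc : c ∉ S) :
    obj w lam d (insert c (S.erase b)) - obj w lam d S =
      w c - w b + lam * (∑ v ∈ S, d c v - d c b - ∑ v ∈ S, d b v) := by
  have h1 : c ∉ S.erase b := fun h => hc (Finset.mem_of_mem_erase h)
  have h2 := obj_insert d hs hr w lam b (S.erase b) (Finset.notMem_erase b S)
  rw [Finset.insert_erase hb] at h2
  rw [obj_insert d hs hr w lam c _ h1, h2,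
    ← Finset.add_sum_erase S (fun v => d c v) hb, ← Finset.add_sum_erase S (fun v => d b v) hb, hr]
  ring

lemma obj_union {U : Type*} [DecidableEq U] (d : U → U → ℝ)
    (hs : ∀ u v, d u v = d v u) (w : U → ℝ) (lam : ℝ)
    (A B : Finset U) (h : Disjoint A B) :
    obj w lam d (A ∪ B) = obj w lam d A + obj w lam d B + lam * ∑ u ∈ A, ∑ v ∈ B, d u v := by
  unfold obj dispSet
  have e : ∑ u ∈ B, ∑ v ∈ A, d u v = ∑ u ∈ A, ∑ v ∈ B, d u v := by
    rw [Finset.sum_comm]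
    exact Finset.sum_congr rfl fun u _ => Finset.sum_congr rfl fun v _ => hs _ _
  simp only [Finset.sum_union h, Finset.sum_add_distrib, e]
  ring

/-- Triangle inequality summed over `C × C × B`. -/
lemma tri_sum {U : Type*} [DecidableEq U] (d : U → U → ℝ)
    (hs : ∀ u v, d u v = d v u) (hr : ∀ u, d u u = 0)
    (ht : ∀ u v w, d u w ≤ d u v + d v w) (B C : Finset U) :
    (B.card : ℝ) * ∑ x ∈ C, ∑ y ∈ C, d x y ≤
      2 * ((C.card : ℝ) - 1) * ∑ x ∈ C, ∑ b ∈ B, d x b := by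
  have key : ∀ b ∈ B, ∑ x ∈ C, ∑ y ∈ C, d x y ≤ 2 * ((C.card : ℝ) - 1) * ∑ x ∈ C, d x b := by
    intro b _
    have h1 : ∀ x ∈ C, ∑ y ∈ C, d x y ≤ ((C.card : ℝ) - 2) * d x b + ∑ y ∈ C, d y b := by
      intro x hx
      rw [← Finset.add_sum_erase C (fun y => d x y) hx, ← Finset.add_sum_erase C (fun y => d y b) hx]
      have h2 : ∑ y ∈ C.erase x, d x y ≤ ∑ y ∈ C.erase x, (d x b + d y b) :=
        Finset.sum_le_sum fun y _ => by rw [hs y b]; exact ht _ _ _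
      rw [Finset.sum_add_distrib, Finset.sum_const, Finset.card_erase_of_mem hx, nsmul_eq_mul,
        Nat.cast_sub (Finset.card_pos.mpr ⟨x, hx⟩)] at h2
      push_cast at h2
      rw [hr]
      linarith
    refine (Finset.sum_le_sum h1).trans (le_of_eq ?_)
    rw [Finset.sum_add_distrib, ← Finset.mul_sum, Finset.sum_const, nsmul_eq_mul]
    ring
  have := Finset.sum_le_sum key
  rw [Finset.sum_const, nsmul_eq_mul, ← Finset.mul_sum, Finset.sum_comm (s := B)] at this
  exact this

lemma local_search {U : Type*} [DecidableEq U] (d : U → U → ℝ)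
    (hn : ∀ u v, 0 ≤ d u v)
    (hs : ∀ u v, d u v = d v u) (hr : ∀ u, d u u = 0)
    (ht : ∀ u v w, d u w ≤ d u v + d v w) (w : U → ℝ) (hw : ∀ u, 0 ≤ w u)
    (lam : ℝ) (hlam : 0 ≤ lam) (S T : Finset U) (hcard : T.card = S.card) (hne : T ≠ S) (D : ℝ)
    (hD : ∀ b ∈ S, ∀ c ∉ S, obj w lam d (insert c (S.erase b)) - obj w lam d S ≤ D) :
    obj w lam d T - 2 * obj w lam d S ≤ ((T \ S).card : ℝ) * D := by
  set A := S ∩ T with hA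
  set B := S \ T with hB
  set C := T \ S with hC
  have hSe : S = A ∪ B := by ext x; simp [hA, hB]; tauto
  have hTe : T = A ∪ C := by ext x; simp [hA, hC]; tauto
  have dAB : Disjoint A B := by
    rw [Finset.disjoint_left]; intro x; simp [hA, hB]; tauto
  have dAC : Disjoint A C := by
    rw [Finset.disjoint_left]; intro x; simp [hA, hC]; tauto
  have hBC : B.card = C.card := by
    have h1 := Finset.card_union_of_disjoint dAB
    have h2 := Finset.card_union_of_disjoint dAC
    rw [← hSe] at h1; rw [← hTe] at h2; omega
  have hk : 0 < C.card := by
    rw [Finset.card_pos]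
    by_contra h
    rw [Finset.not_nonempty_iff_eq_empty, hC, Finset.sdiff_eq_empty_iff_subset] at h
    exact hne (Finset.eq_of_subset_of_card_le h hcard.ge)
  have hk' : (0:ℝ) < C.card := by exact_mod_cast hk
  have hsum : ∑ b ∈ B, ∑ c ∈ C, (w c - w b + lam * (∑ v ∈ S, d c v - d c b - ∑ v ∈ S, d b v))
      ≤ ∑ b ∈ B, ∑ c ∈ C, D := by
    refine Finset.sum_le_sum fun b hb => Finset.sum_le_sum fun c hc => ?_
    have hb' : b ∈ S := (Finset.mem_sdiff.mp hb).1
    have hc' : c ∉ S := (Finset.mem_sdiff.mp hc).2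
    rw [← gain_eq d hs hr w lam S b c hb' hc']
    exact hD b hb' c hc'
  have split : ∀ u, ∑ v ∈ S, d u v = ∑ v ∈ A, d u v + ∑ v ∈ B, d u v := by
    intro u
    have := Finset.sum_union dAB (f := fun v => d u v)
    rwa [← hSe] at this
  have eBA : ∑ u ∈ B, ∑ v ∈ A, d u v = ∑ u ∈ A, ∑ v ∈ B, d u v := by
    rw [Finset.sum_comm]
    exact Finset.sum_congr rfl fun u _ => Finset.sum_congr rfl fun v _ => hs _ _
  have eCA : ∑ u ∈ C, ∑ v ∈ A, d u v = ∑ u ∈ A, ∑ v ∈ C, d u v := by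
    rw [Finset.sum_comm]
    exact Finset.sum_congr rfl fun u _ => Finset.sum_congr rfl fun v _ => hs _ _
  have eBC : ∑ b ∈ B, ∑ c ∈ C, d c b = ∑ c ∈ C, ∑ b ∈ B, d c b := Finset.sum_comm
  simp only [split, Finset.sum_add_distrib, Finset.sum_sub_distrib, ← Finset.mul_sum,
    Finset.sum_const, nsmul_eq_mul, hBC, eBA, eCA, eBC] at hsum
  have htr := tri_sum d hs hr ht B C
  rw [hBC] at htr
  have hoS := obj_union d hs w lam A B dAB
  have hoT := obj_union d hs w lam A C dAC
  rw [← hSe] at hoS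
  rw [← hTe] at hoT
  rw [hoS, hoT]
  unfold obj dispSet
  have wA : 0 ≤ ∑ u ∈ A, w u := Finset.sum_nonneg fun u _ => hw u
  have wB : 0 ≤ ∑ u ∈ B, w u := Finset.sum_nonneg fun u _ => hw u
  have nAA : 0 ≤ lam * ∑ u ∈ A, ∑ v ∈ A, d u v :=
    mul_nonneg hlam (Finset.sum_nonneg fun u _ => Finset.sum_nonneg fun v _ => hn _ _)
  have nAB : 0 ≤ lam * ∑ u ∈ A, ∑ v ∈ B, d u v :=
    mul_nonneg hlam (Finset.sum_nonneg fun u _ => Finset.sum_nonneg fun v _ => hn _ _)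
  have htr' := mul_le_mul_of_nonneg_left htr hlam
  generalize (∑ u ∈ A, w u) = wa at *
  generalize (∑ u ∈ B, w u) = wb at *
  generalize (∑ u ∈ C, w u) = wc at *
  generalize (∑ u ∈ A, ∑ v ∈ A, d u v) = aa at *
  generalize (∑ u ∈ A, ∑ v ∈ B, d u v) = ab at *
  generalize (∑ u ∈ A, ∑ v ∈ C, d u v) = ac at *
  generalize (∑ u ∈ B, ∑ v ∈ B, d u v) = bb at *
  generalize (∑ u ∈ C, ∑ v ∈ C, d u v) = cc at *
  generalize (∑ u ∈ C, ∑ v ∈ B, d u v) = cb at *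
  generalize (C.card : ℝ) = k at *
  refine le_of_mul_le_mul_left ?_ hk'
  have n1 := mul_nonneg hk'.le wA
  have n2 := mul_nonneg hk'.le wB
  have n3 := mul_nonneg hk'.le nAA
  have n4 := mul_nonneg hk'.le nAB
  linarith

/-- Distance decrease: if `S` is a 3-approximation under the metric `d`, and the metric
`d'` decreases the distance of the single pair `{a,b}` by `δ > 0` (all other distances
unchanged), then a single oblivious update restores the 3-approximation under `d'`. -/
theorem stmt_17 {U : Type*} [Fintype U] [DecidableEq U] (d d' : U → U → ℝ)
    (hsymm : ∀ u v, d u v = d v u)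
    (hnonneg : ∀ u v, 0 ≤ d u v)
    (hrefl : ∀ u, d u u = 0)
    (htri : ∀ u v w, d u w ≤ d u v + d v w)
    (hsymm' : ∀ u v, d' u v = d' v u)
    (hnonneg' : ∀ u v, 0 ≤ d' u v)
    (hrefl' : ∀ u, d' u u = 0)
    (htri' : ∀ u v w, d' u w ≤ d' u v + d' v w)
    (a b : U) (hab : a ≠ b) (δ : ℝ) (hδ : 0 < δ)
    (hchange : d' a b = d a b - δ)
    (hsame : ∀ u v, ¬((u = a ∧ v = b) ∨ (u = b ∧ v = a)) → d' u v = d u v)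
    (w : U → ℝ) (hw : ∀ u, 0 ≤ w u)
    (lam : ℝ) (hlam : 0 ≤ lam)
    (p : ℕ) (S : Finset U) (hS : S.card = p)
    (happrox : ∀ T : Finset U, T.card = p → obj w lam d S ≥ (1 / 3) * obj w lam d T) :
    ∀ T : Finset U, T.card = p →
      obj w lam d' S + bestGain (obj w lam d') S ≥ (1 / 3) * obj w lam d' T := by
  intro T hT
  have hG0 : 0 ≤ bestGain (obj w lam d') S :=
    Finset.le_max' _ _ (Finset.mem_insert_self _ _)
  have hG : ∀ y ∈ S, ∀ x ∉ S, obj w lam d' (insert x (S.erase y)) - obj w lam d' S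
      ≤ bestGain (obj w lam d') S := by
    intro y hy x hx
    refine Finset.le_max' _ _ (Finset.mem_insert_of_mem ?_)
    exact Finset.mem_image.mpr ⟨(y, x), by simp [hy, hx], rfl⟩
  have hle : ∀ u v, d' u v ≤ d u v := by
    intro u v
    by_cases h : (u = a ∧ v = b) ∨ (u = b ∧ v = a)
    · rcases h with ⟨rfl, rfl⟩ | ⟨rfl, rfl⟩
      · linarith
      · rw [hsymm', hsymm u v]; linarith
    · exact (hsame u v h).le
  have hTle : obj w lam d' T ≤ obj w lam d T := by
    unfold obj dispSet
    have : ∑ u ∈ T, ∑ v ∈ T, d' u v ≤ ∑ u ∈ T, ∑ v ∈ T, d u v :=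
      Finset.sum_le_sum fun u _ => Finset.sum_le_sum fun v _ => hle u v
    have := mul_le_mul_of_nonneg_left this hlam
    linarith
  have hSn : 0 ≤ obj w lam d' S := by
    unfold obj dispSet
    have h1 : 0 ≤ ∑ u ∈ S, w u := Finset.sum_nonneg fun u _ => hw u
    have h2 : 0 ≤ ∑ u ∈ S, ∑ v ∈ S, d' u v :=
      Finset.sum_nonneg fun u _ => Finset.sum_nonneg fun v _ => hnonneg' u v
    positivity
  have hap := happrox T hT
  by_cases hin : a ∈ S ∧ b ∈ S
  swap
  · have : obj w lam d' S = obj w lam d S := by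
      unfold obj dispSet
      congr 3
      refine Finset.sum_congr rfl fun u hu => Finset.sum_congr rfl fun v hv => hsame u v ?_
      rintro (⟨rfl, rfl⟩ | ⟨rfl, rfl⟩)
      · exact hin ⟨hu, hv⟩
      · exact hin ⟨hv, hu⟩
    linarith
  obtain ⟨ha, hb⟩ := hin
  by_cases hTS : T = S
  · subst hTS
    linarith
  -- decompose S
  set R := (S.erase a).erase b with hR
  have hbSa : b ∈ S.erase a := Finset.mem_erase.mpr ⟨hab.symm, hb⟩
  have hbR : b ∉ R := Finset.notMem_erase _ _
  have haR : a ∉ insert b R := by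
    rw [hR, Finset.insert_erase hbSa]; exact Finset.notMem_erase _ _
  have hSR : S = insert a (insert b R) := by
    rw [hR, Finset.insert_erase hbSa, Finset.insert_erase ha]
  have hcardR : (R.card : ℝ) = p - 2 := by
    have : S.card = R.card + 2 := by
      rw [hSR, Finset.card_insert_of_notMem haR, Finset.card_insert_of_notMem hbR]
    rw [← hS, this]; push_cast; ring
  have hsameR : ∀ u ∈ R, ∀ v, d' u v = d u v := by
    intro u hu v
    apply hsame
    rintro (⟨rfl, rfl⟩ | ⟨rfl, rfl⟩)
    · exact haR (Finset.mem_insert_of_mem hu)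
    · exact hbR hu
  have e' : obj w lam d' S = obj w lam d' R + w b + lam * ∑ v ∈ R, d' b v + w a
      + lam * (d' a b + ∑ v ∈ R, d' a v) := by
    rw [hSR, obj_insert d' hsymm' hrefl' w lam a _ haR, obj_insert d' hsymm' hrefl' w lam b _ hbR,
      Finset.sum_insert hbR]
  have e : obj w lam d S = obj w lam d R + w b + lam * ∑ v ∈ R, d b v + w a
      + lam * (d a b + ∑ v ∈ R, d a v) := by
    rw [hSR, obj_insert d hsymm hrefl w lam a _ haR, obj_insert d hsymm hrefl w lam b _ hbR,
      Finset.sum_insert hbR]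
  have eR : obj w lam d' R = obj w lam d R := by
    unfold obj dispSet
    congr 3
    exact Finset.sum_congr rfl fun u hu => Finset.sum_congr rfl fun v _ => hsameR u hu v
  have ea : ∑ v ∈ R, d' a v = ∑ v ∈ R, d a v :=
    Finset.sum_congr rfl fun v hv => by rw [hsymm', hsymm a v]; exact hsameR v hv a
  have eb : ∑ v ∈ R, d' b v = ∑ v ∈ R, d b v :=
    Finset.sum_congr rfl fun v hv => by rw [hsymm', hsymm b v]; exact hsameR v hv b
  have hdiff : obj w lam d S = obj w lam d' S + lam * δ := by
    rw [e, e', eR, ea, eb, hchange]; ring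
  have hRn : 0 ≤ obj w lam d' R := by
    unfold obj dispSet
    have h1 : 0 ≤ ∑ u ∈ R, w u := Finset.sum_nonneg fun u _ => hw u
    have h2 : 0 ≤ ∑ u ∈ R, ∑ v ∈ R, d' u v :=
      Finset.sum_nonneg fun u _ => Finset.sum_nonneg fun v _ => hnonneg' u v
    positivity
  have hδR : ((p : ℝ) - 2) * δ ≤ ∑ v ∈ R, d a v + ∑ v ∈ R, d b v := by
    rw [← hcardR, ← Finset.sum_add_distrib, ← nsmul_eq_mul, ← Finset.sum_const]
    refine Finset.sum_le_sum fun v _ => ?_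
    have h1 := htri a v b
    have h2 := hnonneg' a b
    rw [hsymm b v]
    linarith
  have hlow : ((p : ℝ) - 2) * (lam * δ) ≤ obj w lam d' S := by
    have h1 := mul_le_mul_of_nonneg_left hδR hlam
    have h2 := mul_nonneg hlam (hnonneg' a b)
    have h3 := hw a
    have h4 := hw b
    rw [e', ea, eb]
    linarith
  have hls := local_search d' hnonneg' hsymm' hrefl' htri' w hw lam hlam S T (hT.trans hS.symm)
    hTS _ hG
  have hkp : ((T \ S).card : ℝ) ≤ p := by
    rw [← hT]; exact_mod_cast Finset.card_le_card Finset.sdiff_subset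
  have hls2 := hls.trans (mul_le_mul_of_nonneg_right hkp hG0)
  have hp2 : (0 : ℝ) ≤ p - 2 := by rw [← hcardR]; exact Nat.cast_nonneg _
  generalize obj w lam d' S = s at *
  generalize obj w lam d' T = t at *
  generalize bestGain (obj w lam d') S = D at *
  by_contra hcon
  push Not at hcon
  have hε : t / 3 - s ≤ lam * δ := by linarith
  have h1 := (mul_le_mul_of_nonneg_left hε hp2).trans hlow
  have hppos : (0 : ℝ) < p := by linarith
  have h2 := mul_lt_mul_of_pos_left hcon hppos
  linarith
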